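/- For every integer n ≥ 7 and every t with 0 ≤ t ≤ r_{n+4} − r_{n+3}, one has (2 r_{n+4} − t) · H_n(r_{n+4} − t) ≤ 2 r_{n+4} · H_n(r_{n+4}). -/

import Mathlib

open Real

/-- `h_n(s) = e^{-s²/4} s^n`. -/
noncomputable def hfun (n : ℕ) (s : ℝ) : ℝ := Real.exp (-s ^ 2 / 4) * s ^ n

/-- `H_n(s) = h_n(s-2) + h_n(s+2)`. -/
noncomputable def Hfun (n : ℕ) (s : ℝ) : ℝ := hfun n (s - 2) + hfun n (s + 2)

/-- `r_m = √(2(m-1))`. -/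
noncomputable def rrad (m : ℕ) : ℝ := Real.sqrt (2 * ((m : ℝ) - 1))

theorem hasDerivAt_hfun_succ (m : ℕ) (u : ℝ) :
    HasDerivAt (hfun (m + 1)) (Real.exp (-u ^ 2 / 4) * u ^ m * ((m + 1) - u ^ 2 / 2)) u := by
  have hq : HasDerivAt (fun v : ℝ => -v ^ 2 / 4) (-(2 * u) / 4) u := by
    simpa using ((hasDerivAt_pow 2 u).neg.div_const 4)
  have hp : HasDerivAt (fun v : ℝ => v ^ (m + 1)) ((m + 1) * u ^ m) u := by
    simpa using hasDerivAt_pow (m + 1) u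
  refine (hq.exp.mul hp).congr_deriv ?_
  ring

theorem hasDerivAt_Hfun_succ (m : ℕ) (s : ℝ) :
    HasDerivAt (Hfun (m + 1))
      (Real.exp (-(s - 2) ^ 2 / 4) * (s - 2) ^ m * ((m + 1) - (s - 2) ^ 2 / 2)
        + Real.exp (-(s + 2) ^ 2 / 4) * (s + 2) ^ m * ((m + 1) - (s + 2) ^ 2 / 2)) s :=
  ((hasDerivAt_hfun_succ m (s - 2)).comp_sub_const s 2).add
    ((hasDerivAt_hfun_succ m (s + 2)).comp_add_const s 2)

theorem log_ratio_le {s : ℝ} (hs : 2 < s) :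
    Real.log ((s + 2) / (s - 2)) ≤ 4 * s / (s ^ 2 - 4) := by
  have h2 : 0 < s - 2 := by linarith
  have hx : 1 ≤ (s + 2) / (s - 2) := by rw [one_le_div h2]; linarith
  have h := Real.self_le_sinh_iff.2 (Real.log_nonneg hx)
  rw [Real.sinh_log (by linarith)] at h
  refine h.trans (le_of_eq ?_)
  have h3 : s + 2 ≠ 0 := by linarith
  have h4 : s ^ 2 - 4 ≠ 0 := by nlinarith
  field_simp
  ring

theorem le_log_ratio {s : ℝ} (hs : 2 < s) :
    4 / (s + 2) ≤ Real.log ((s + 2) / (s - 2)) := by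
  have h2 : 0 < s - 2 := by linarith
  have h3 : 0 < s + 2 := by linarith
  have h := Real.one_sub_inv_le_log_of_pos (div_pos h3 h2)
  refine (le_of_eq ?_).trans h
  field_simp
  ring

theorem log_weighted_ratio_le {s x : ℝ} (hs : 10 / 3 ≤ s) (h1 : 2 * x + 4 ≤ s ^ 2)
    (h2 : s ^ 2 ≤ 2 * x + 6) :
    (x - 1) * Real.log ((s + 2) / (s - 2))
      + Real.log (((s + 2) ^ 2 - 2 * x) / (2 * x - (s - 2) ^ 2)) ≤ 2 * s := by
  have hm : 0 < s - 2 := by linarith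
  have hp : 0 < s + 2 := by linarith
  have hA : 0 < (s + 2) ^ 2 - 2 * x := by nlinarith
  have hBs : s ≤ 2 * x - (s - 2) ^ 2 := by nlinarith
  have hB : 0 < 2 * x - (s - 2) ^ 2 := by linarith
  have hL := log_ratio_le (s := s) (by linarith)
  have hL' := le_log_ratio (s := s) (by linarith)
  set L := Real.log ((s + 2) / (s - 2))
  set A := (s + 2) ^ 2 - 2 * x with hAdef
  set B := 2 * x - (s - 2) ^ 2 with hBdef
  have hM : Real.log (A / B) ≤ L + 2 * (s ^ 2 - 2 * x - 4) / (s + 2) := by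
    have hfac : A / B = (s + 2) / (s - 2) * (A * (s - 2) / (B * (s + 2))) := by
      field_simp
    rw [hfac, Real.log_mul (by positivity) (by positivity)]
    have hlog := Real.log_le_sub_one_of_pos (x := A * (s - 2) / (B * (s + 2))) (by positivity)
    have hsub : A * (s - 2) / (B * (s + 2)) - 1
        = 2 * (s ^ 2 - 2 * x - 4) / (s + 2) * (s / B) := by
      field_simp
      rw [hAdef, hBdef]
      ring
    have hle : 2 * (s ^ 2 - 2 * x - 4) / (s + 2) * (s / B)
        ≤ 2 * (s ^ 2 - 2 * x - 4) / (s + 2) :=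
      mul_le_of_le_one_right (div_nonneg (by linarith) hp.le) ((div_le_one hB).2 hBs)
    linarith
  have hq : 0 < s ^ 2 - 4 := by nlinarith
  have hupper : (s ^ 2 - 4) * L ≤ 4 * s := by
    rw [le_div_iff₀ hq] at hL
    linarith
  have hlower : 2 * (s ^ 2 - 2 * x - 4) / (s + 2) ≤ (s ^ 2 - 2 * x - 4) / 2 * L := by
    calc 2 * (s ^ 2 - 2 * x - 4) / (s + 2) = (s ^ 2 - 2 * x - 4) / 2 * (4 / (s + 2)) := by ring
      _ ≤ _ := mul_le_mul_of_nonneg_left hL' (by linarith)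
  linarith

theorem deriv_Hfun_succ_nonneg {m : ℕ} {s : ℝ} (hs : 10 / 3 ≤ s)
    (h1 : 2 * ((m : ℝ) + 1) + 4 ≤ s ^ 2) (h2 : s ^ 2 ≤ 2 * ((m : ℝ) + 1) + 6) :
    0 ≤ deriv (Hfun (m + 1)) s := by
  rw [(hasDerivAt_Hfun_succ m s).deriv]
  have hm : 0 < s - 2 := by linarith
  have hp : 0 < s + 2 := by linarith
  have hA : 0 < (s + 2) ^ 2 - 2 * ((m : ℝ) + 1) := by nlinarith
  have hB : 0 < 2 * ((m : ℝ) + 1) - (s - 2) ^ 2 := by nlinarith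
  have h := log_weighted_ratio_le hs h1 h2
  rw [add_sub_cancel_right, ← Real.log_pow, ← Real.log_mul (by positivity) (by positivity),
    Real.log_le_iff_le_exp (by positivity), div_pow, div_mul_div_comm,
    div_le_iff₀ (by positivity)] at h
  have hexp : Real.exp (-(s - 2) ^ 2 / 4) = Real.exp (-(s + 2) ^ 2 / 4) * Real.exp (2 * s) := by
    rw [← Real.exp_add]
    ring_nf
  rw [hexp]
  have h' := mul_le_mul_of_nonneg_left h (Real.exp_pos (-(s + 2) ^ 2 / 4)).le
  linarith

theorem monotoneOn_Hfun {n : ℕ} (hn : 4 ≤ n) :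
    MonotoneOn (Hfun n) (Set.Icc (rrad (n + 3)) (rrad (n + 4))) := by
  obtain ⟨m, rfl⟩ : ∃ m, n = m + 1 := ⟨n - 1, by omega⟩
  have hd : Differentiable ℝ (Hfun (m + 1)) := fun s =>
    (hasDerivAt_Hfun_succ m s).differentiableAt
  refine monotoneOn_of_deriv_nonneg (convex_Icc _ _) hd.continuous.continuousOn
    hd.differentiableOn fun s hs => ?_
  rw [interior_Icc] at hs
  obtain ⟨hs1, hs2⟩ := hs
  have hm : (3 : ℝ) ≤ m := by exact_mod_cast (by omega : 3 ≤ m)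
  have hs0 : 0 < s := (Real.sqrt_nonneg _).trans_lt hs1
  unfold rrad at hs1 hs2
  rw [Real.sqrt_lt' hs0] at hs1
  rw [Real.lt_sqrt hs0.le] at hs2
  push_cast at hs1 hs2
  exact deriv_Hfun_succ_nonneg (by nlinarith) (by linarith) (by linarith)

/-- **Appendix proposition, first half:** for `n ≥ 7` and `0 ≤ t ≤ r_{n+4} - r_{n+3}`,
`(2 r_{n+4} - t) H_n(r_{n+4} - t) ≤ 2 r_{n+4} H_n(r_{n+4})`. -/
theorem pointwise_left (n : ℕ) (hn : 7 ≤ n) (t : ℝ) (ht0 : 0 ≤ t)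
    (ht1 : t ≤ rrad (n + 4) - rrad (n + 3)) :
    (2 * rrad (n + 4) - t) * Hfun n (rrad (n + 4) - t)
      ≤ 2 * rrad (n + 4) * Hfun n (rrad (n + 4)) := by
  have hR : 2 ≤ rrad (n + 3) := by
    have hn' : (7 : ℝ) ≤ n := by exact_mod_cast hn
    refine Real.le_sqrt_of_sq_le ?_
    push_cast
    linarith
  have hmono := monotoneOn_Hfun (n := n) (by omega)
    (a := rrad (n + 4) - t) ⟨by linarith, by linarith⟩
    (b := rrad (n + 4)) ⟨by linarith, le_rfl⟩ (by linarith)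
  have hpos : 0 ≤ Hfun n (rrad (n + 4) - t) :=
    add_nonneg (mul_nonneg (Real.exp_pos _).le (pow_nonneg (by linarith) n))
      (mul_nonneg (Real.exp_pos _).le (pow_nonneg (by linarith) n))
  exact mul_le_mul (by linarith) hmono hpos (by linarith)
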